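/- Let H be a finite-dimensional Hopf algebra over a field K of characteristic zero and α a Hopf 2-cocycle on H. For f ∈ H* let A_f : ^αH → ^αH be A_f(x) = x₁ f(x₂), and for h ∈ H let T_h : ^αH → ^αH ⊗ ^αH be T_h(x) = (x ·_α S̃(h₁)) ⊗ h₂. Write Δ_{H*}(f) = f₁ ⊗ f₂ for the element of H* ⊗ H* determined by f(ab) = f₁(a)f₂(b). Then for all f ∈ H*, h, g ∈ H and x, y ∈ ^αH: (1) A_f(x ·_α y) = A_{f₁}(x) ·_α A_{f₂}(y); (2) (id ⊗ A_f)(T_h(x)) = T_{h₁ f(h₂)}(x), where T_{h₁ f(h₂)}(x) means f(h₂)·(x ·_α S̃(h₁₁)) ⊗ h₁₂ summed in Sweedler notation; (3) (A_f ⊗ id)(T_h(x)) = f₂(S(h₁)) T_{h₂}(A_{f₁}(x)); (4) (T_h ⊗ id)(T_g(x)) = (id ⊗ T_{g₂})(T_{h g₁}(x)). -/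

import Mathlib

open TensorProduct LinearMap

universe u

section HopfDefs

variable (K : Type u) [Field K]

/-- Convolution product of two linear maps from a coalgebra `C` to an algebra `A`. -/
noncomputable def convH {C A : Type u} [AddCommGroup C] [Module K C] [Coalgebra K C]
    [Ring A] [Algebra K A] (f g : C →ₗ[K] A) : C →ₗ[K] A :=
  LinearMap.mul' K A ∘ₗ TensorProduct.map f g ∘ₗ Coalgebra.comul

variable (H : Type u) [Ring H] [HopfAlgebra K H]

/-- `x ⊗ y ↦ α(x₁ ⊗ y₁) • x₂ * y₂`, the multiplication of the cocycle deformation `^αH`. -/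
noncomputable def aMul (α : H ⊗[K] H →ₗ[K] K) : H ⊗[K] H →ₗ[K] H :=
  convH K (Algebra.linearMap K H ∘ₗ α) (LinearMap.mul' K H)

/-- `x ⊗ (y ⊗ z) ↦ α(x₁,y₁) α(x₂y₂, z)` -/
noncomputable def cocycleLHS (α : H ⊗[K] H →ₗ[K] K) : H ⊗[K] (H ⊗[K] H) →ₗ[K] K :=
  convH K
    (LinearMap.mul' K K ∘ₗ TensorProduct.map α Coalgebra.counit ∘ₗ
      (TensorProduct.assoc K H H H).symm.toLinearMap)
    (α ∘ₗ TensorProduct.map (LinearMap.mul' K H) LinearMap.id ∘ₗ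
      (TensorProduct.assoc K H H H).symm.toLinearMap)

/-- `x ⊗ (y ⊗ z) ↦ α(y₁,z₁) α(x, y₂z₂)` -/
noncomputable def cocycleRHS (α : H ⊗[K] H →ₗ[K] K) : H ⊗[K] (H ⊗[K] H) →ₗ[K] K :=
  convH K
    (LinearMap.mul' K K ∘ₗ TensorProduct.map Coalgebra.counit α)
    (α ∘ₗ TensorProduct.map LinearMap.id (LinearMap.mul' K H))

/-- A Hopf 2-cocycle on `H`: convolution invertible, satisfying the associativity (cocycle)
condition and the unity condition. -/
structure IsHopfCocycle (α : H ⊗[K] H →ₗ[K] K) : Prop where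
  conv_invertible : ∃ β : H ⊗[K] H →ₗ[K] K,
    convH K α β = Coalgebra.counit ∧ convH K β α = Coalgebra.counit
  cocycle : cocycleLHS K H α = cocycleRHS K H α
  unit_left : ∀ x : H, α (1 ⊗ₜ[K] x) = Coalgebra.counit x
  unit_right : ∀ x : H, α (x ⊗ₜ[K] 1) = Coalgebra.counit x

/-- `γ(x) = α(x₁, S(x₂))`. -/
noncomputable def cocycleGamma (α : H ⊗[K] H →ₗ[K] K) : H →ₗ[K] K :=
  α ∘ₗ TensorProduct.map LinearMap.id (HopfAlgebra.antipode (R := K)) ∘ₗ Coalgebra.comul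

/-- The twisted antipode `S̃(x) = γ'(x₂) • S(x₁)`, where `γ'` is the convolution inverse
of `γ`. -/
noncomputable def tAntipode (γ' : H →ₗ[K] K) : H →ₗ[K] H :=
  convH K (HopfAlgebra.antipode (R := K)) (Algebra.linearMap K H ∘ₗ γ')

/-- `A_f : x ↦ f(x₂) • x₁`, the action of `f ∈ H*` on `^αH`. -/
noncomputable def Af (f : H →ₗ[K] K) : H →ₗ[K] H :=
  convH K LinearMap.id (Algebra.linearMap K H ∘ₗ f)

/-- The map `M : x ⊗ y ↦ (x ·_α y₁) ⊗ y₂`. -/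
noncomputable def Mmap (α : H ⊗[K] H →ₗ[K] K) : H ⊗[K] H →ₗ[K] H ⊗[K] H :=
  TensorProduct.map (aMul K H α) LinearMap.id ∘ₗ
    (TensorProduct.assoc K H H H).symm.toLinearMap ∘ₗ
      TensorProduct.map LinearMap.id Coalgebra.comul

/-- The map `T : x ⊗ h ↦ (x ·_α S̃(h₁)) ⊗ h₂`. -/
noncomputable def Tmap (α : H ⊗[K] H →ₗ[K] K) (γ' : H →ₗ[K] K) :
    H ⊗[K] H →ₗ[K] H ⊗[K] H :=
  TensorProduct.map (aMul K H α) LinearMap.id ∘ₗ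
    (TensorProduct.assoc K H H H).symm.toLinearMap ∘ₗ
      TensorProduct.map LinearMap.id
        (TensorProduct.map (tAntipode K H γ') LinearMap.id ∘ₗ Coalgebra.comul)

/-- `ν ↦ (x ↦ ν(x₁) • x₂)`. -/
noncomputable def nuMap (ν : H →ₗ[K] K) : H →ₗ[K] H :=
  convH K (Algebra.linearMap K H ∘ₗ ν) LinearMap.id

/-- `φ : H →ₗ[K] H` is an isomorphism of `H`-comodule algebras `^αH → ^{α'}H`. -/
noncomputable def IsDeformIso (α α' : H ⊗[K] H →ₗ[K] K) (φ : H →ₗ[K] H) : Prop :=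
  Function.Bijective φ ∧ φ 1 = 1 ∧
    φ ∘ₗ aMul K H α = aMul K H α' ∘ₗ TensorProduct.map φ φ ∧
    Coalgebra.comul ∘ₗ φ = TensorProduct.map φ LinearMap.id ∘ₗ (Coalgebra.comul (A := H))

end HopfDefs

/-- The rearrangement `(x₁ ⊗ h₁) ⊗ (x₂ ⊗ h₂) ↦ (x₁ ⊗ h₂) ⊗ (x₂ ⊗ h₁)`. -/
noncomputable def swapPerm (K H : Type u) [Field K] [Ring H] [HopfAlgebra K H] :
    (H ⊗[K] H) ⊗[K] (H ⊗[K] H) →ₗ[K] (H ⊗[K] H) ⊗[K] (H ⊗[K] H) :=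
  (TensorProduct.tensorTensorTensorComm K H H H H).toLinearMap ∘ₗ
    TensorProduct.map LinearMap.id (TensorProduct.comm K H H).toLinearMap ∘ₗ
      (TensorProduct.tensorTensorTensorComm K H H H H).toLinearMap

section CocycleDeformation

open Coalgebra HopfAlgebra WithConv

section Conv
variable {K C D A : Type u} [Field K] [AddCommGroup C] [Module K C] [Coalgebra K C]
  [AddCommGroup D] [Module K D] [Coalgebra K D] [Ring A] [Algebra K A]

theorem convH_apply (f g : C →ₗ[K] A) (c : C) :
    convH K f g c = mul' K A (TensorProduct.map f g (comul c)) := rfl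

theorem comul_tmul_eq (c : C) (d : D) :
    comul (R := K) (c ⊗ₜ[K] d) =
      tensorTensorTensorComm K C C D D (comul c ⊗ₜ comul d) := rfl

theorem convH_assoc (f g h : C →ₗ[K] A) :
    convH K (convH K f g) h = convH K f (convH K g h) :=
  congrArg WithConv.ofConv (mul_assoc (toConv f) (toConv g) (toConv h))

theorem counit_convH (f : C →ₗ[K] K) : convH K counit f = f :=
  congrArg WithConv.ofConv (one_mul (toConv f))

theorem convH_counit (f : C →ₗ[K] K) : convH K f counit = f :=
  congrArg WithConv.ofConv (mul_one (toConv f))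

theorem convH_comp_coalgHom (f g : D →ₗ[K] A) (φ : C →ₗc[K] D) :
    convH K f g ∘ₗ φ.toLinearMap = convH K (f ∘ₗ φ.toLinearMap) (g ∘ₗ φ.toLinearMap) :=
  LinearMap.convMul_comp_coalgHom_distrib (toConv f) (toConv g) φ

theorem linearMap_comp_convH (f g : C →ₗ[K] K) :
    Algebra.linearMap K A ∘ₗ convH K f g =
      convH K (Algebra.linearMap K A ∘ₗ f) (Algebra.linearMap K A ∘ₗ g) :=
  LinearMap.algHom_comp_convMul_distrib (Algebra.ofId K A) (toConv f) (toConv g)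

/-- Postcomposition is compatible with convolution by a functional on the left. -/
theorem comp_convH_left {B : Type u} [Ring B] [Algebra K B] (L : A →ₗ[K] B) (u : C →ₗ[K] K)
    (v : C →ₗ[K] A) :
    L ∘ₗ convH K (Algebra.linearMap K A ∘ₗ u) v =
      convH K (Algebra.linearMap K B ∘ₗ u) (L ∘ₗ v) := by
  have : L ∘ₗ mul' K A ∘ₗ TensorProduct.map (Algebra.linearMap K A ∘ₗ u) v =
      mul' K B ∘ₗ TensorProduct.map (Algebra.linearMap K B ∘ₗ u) (L ∘ₗ v) := by
    ext a b
    simp [← Algebra.smul_def]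
  ext c
  exact congr($this (comul c))

theorem comp_map_id_convH {B : Type u} [Ring B] [Algebra K B] (F : C ⊗[K] A →ₗ[K] B)
    (u : D →ₗ[K] K) (v : D →ₗ[K] A) :
    F ∘ₗ TensorProduct.map LinearMap.id (convH K (Algebra.linearMap K A ∘ₗ u) v) =
      convH K (Algebra.linearMap K B ∘ₗ mul' K K ∘ₗ TensorProduct.map counit u)
        (F ∘ₗ TensorProduct.map LinearMap.id v) := by
  ext c d
  have key : ∀ (s : C ⊗[K] C) (t : D ⊗[K] D),
      F (TensorProduct.lid K C (TensorProduct.map counit LinearMap.id s) ⊗ₜ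
        mul' K A (TensorProduct.map (Algebra.linearMap K A ∘ₗ u) v t)) =
      mul' K B (TensorProduct.map
        (Algebra.linearMap K B ∘ₗ mul' K K ∘ₗ TensorProduct.map counit u)
        (F ∘ₗ TensorProduct.map LinearMap.id v)
        (tensorTensorTensorComm K C C D D (s ⊗ₜ t))) := by
    intro s t
    induction s with
    | zero => simp
    | add s s' h h' => simp only [add_tmul, map_add, h, h']
    | tmul a b =>
      induction t with
      | zero => simp
      | add t t' h h' => simp only [tmul_add, map_add, h, h']
      | tmul a' b' =>
        simp [← Algebra.smul_def, ← smul_tmul', smul_smul, mul_comm]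
  have h := key (comul c) (comul d)
  have h1 : TensorProduct.map counit LinearMap.id (comul (R := K) c) = (1 : K) ⊗ₜ c :=
    rTensor_counit_comul c
  rw [h1] at h
  simpa [convH_apply, AlgebraTensorModule.tensorTensorTensorComm_eq] using h

theorem comp_map_convH_id {B : Type u} [Ring B] [Algebra K B] (F : A ⊗[K] C →ₗ[K] B)
    (u : D →ₗ[K] K) (v : D →ₗ[K] A) :
    F ∘ₗ TensorProduct.map (convH K (Algebra.linearMap K A ∘ₗ u) v) LinearMap.id =
      convH K (Algebra.linearMap K B ∘ₗ mul' K K ∘ₗ TensorProduct.map u counit)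
        (F ∘ₗ TensorProduct.map v LinearMap.id) := by
  ext d c
  have key : ∀ (t : D ⊗[K] D) (s : C ⊗[K] C),
      F (mul' K A (TensorProduct.map (Algebra.linearMap K A ∘ₗ u) v t) ⊗ₜ
        TensorProduct.lid K C (TensorProduct.map counit LinearMap.id s)) =
      mul' K B (TensorProduct.map
        (Algebra.linearMap K B ∘ₗ mul' K K ∘ₗ TensorProduct.map u counit)
        (F ∘ₗ TensorProduct.map v LinearMap.id)
        (tensorTensorTensorComm K D D C C (t ⊗ₜ s))) := by
    intro t s
    induction t with
    | zero => simp
    | add s s' h h' => simp only [add_tmul, map_add, h, h']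
    | tmul a b =>
      induction s with
      | zero => simp
      | add t t' h h' => simp only [tmul_add, map_add, h, h']
      | tmul a' b' =>
        simp [← Algebra.smul_def, ← smul_tmul', smul_smul, mul_comm]
  have h := key (comul d) (comul c)
  have h1 : TensorProduct.map counit LinearMap.id (comul (R := K) c) = (1 : K) ⊗ₜ c :=
    rTensor_counit_comul c
  rw [h1] at h
  simpa [convH_apply, AlgebraTensorModule.tensorTensorTensorComm_eq] using h

end Conv

section Hopf
variable {K H : Type u} [Field K] [Ring H] [HopfAlgebra K H]

theorem map_comul_comul_apply {C : Type u} [AddCommGroup C] [Module K C] [Coalgebra K C] (x : C) :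
    TensorProduct.map comul comul (comul (R := K) x) =
      (TensorProduct.assoc K C C (C ⊗[K] C)).symm
        (TensorProduct.map LinearMap.id
          ((TensorProduct.assoc K C C C).toLinearMap ∘ₗ TensorProduct.map comul LinearMap.id ∘ₗ
            comul) (comul x)) := by
  have e : (TensorProduct.assoc K C C C).toLinearMap ∘ₗ TensorProduct.map comul LinearMap.id ∘ₗ
      comul = TensorProduct.map LinearMap.id comul ∘ₗ (comul (R := K) (A := C)) := coassoc
  have h1 := congr((TensorProduct.map LinearMap.id (comul (R := K) (A := C)))
    $(coassoc_symm_apply (R := K) x))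
  rw [e]
  have e1 : (TensorProduct.map (LinearMap.id (R := K) (M := C ⊗[K] C)) comul) ∘ₗ comul.rTensor C =
      TensorProduct.map (comul (R := K) (A := C)) (comul (R := K) (A := C)) := by
    ext; simp
  have e2 : (TensorProduct.map (LinearMap.id (R := K) (M := C ⊗[K] C)) (comul (R := K) (A := C)))
      ∘ₗ (TensorProduct.assoc K C C C).symm.toLinearMap =
      (TensorProduct.assoc K C C (C ⊗[K] C)).symm.toLinearMap ∘ₗ
        TensorProduct.map LinearMap.id (TensorProduct.map LinearMap.id comul) := by
    ext; simp
  have e3 : TensorProduct.map LinearMap.id (TensorProduct.map LinearMap.id comul ∘ₗ comul) =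
      TensorProduct.map LinearMap.id (TensorProduct.map LinearMap.id comul) ∘ₗ
        (comul (R := K) (A := C)).lTensor C := by
    ext; simp
  rw [← e1, e3]
  simp only [LinearMap.comp_apply]
  rw [← h1]
  exact congr($e2 ((comul (R := K) (A := C)).lTensor C (comul x)))

/-- In Sweedler form, `S(x₂) x₃ ⊗ S(x₁) x₄ = ε(x) 1 ⊗ 1`. -/
theorem convH_antipode_comul :
    convH K (TensorProduct.map (antipode K) (antipode K) ∘ₗ
        (TensorProduct.comm K H H).toLinearMap ∘ₗ comul) (comul (R := K) (A := H)) =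
      Algebra.linearMap K (H ⊗[K] H) ∘ₗ counit := by
  have key : mul' K (H ⊗[K] H) ∘ₗ
      TensorProduct.map (TensorProduct.map (antipode K) (antipode K) ∘ₗ
        (TensorProduct.comm K H H).toLinearMap) LinearMap.id ∘ₗ
      (TensorProduct.assoc K H H (H ⊗[K] H)).symm.toLinearMap ∘ₗ
      TensorProduct.map LinearMap.id
        ((TensorProduct.assoc K H H H).toLinearMap ∘ₗ TensorProduct.map comul LinearMap.id) =
      TensorProduct.mk K H H 1 ∘ₗ mul' K H ∘ₗ TensorProduct.map (antipode K)
        ((TensorProduct.lid K H).toLinearMap ∘ₗ TensorProduct.map counit LinearMap.id) := by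
    ext a b c
    have h : ∀ t : H ⊗[K] H, mul' K (H ⊗[K] H)
        (TensorProduct.map (TensorProduct.map (antipode K) (antipode K) ∘ₗ
        (TensorProduct.comm K H H).toLinearMap) LinearMap.id
        ((TensorProduct.assoc K H H (H ⊗[K] H)).symm (a ⊗ₜ
          (TensorProduct.assoc K H H H (t ⊗ₜ c))))) =
        mul' K H (TensorProduct.map (antipode K) LinearMap.id t) ⊗ₜ
          (antipode K a * c) := by
      intro t
      induction t with
      | zero => simp
      | add s t hs ht => simp only [add_tmul, tmul_add, map_add, hs, ht]
      | tmul p q => simp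
    have hb : mul' K H (TensorProduct.map (antipode K) LinearMap.id (comul b)) =
      algebraMap K H (counit b) := mul_antipode_rTensor_comul_apply b
    simp [h, hb, Algebra.algebraMap_eq_smul_one, smul_tmul']
  ext x
  have h1 : ∀ t : H ⊗[K] H, TensorProduct.map (TensorProduct.map (antipode K) (antipode K) ∘ₗ
        (TensorProduct.comm K H H).toLinearMap ∘ₗ comul) (comul (R := K) (A := H)) t =
      TensorProduct.map (TensorProduct.map (antipode K) (antipode K) ∘ₗ
        (TensorProduct.comm K H H).toLinearMap) LinearMap.id (TensorProduct.map comul comul t) := by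
    intro t
    rw [← LinearMap.comp_apply, ← TensorProduct.map_comp]
    rfl
  have h2 : ∀ t : H ⊗[K] H, TensorProduct.map LinearMap.id
          ((TensorProduct.assoc K H H H).toLinearMap ∘ₗ TensorProduct.map comul LinearMap.id ∘ₗ
            comul) t = TensorProduct.map LinearMap.id
        ((TensorProduct.assoc K H H H).toLinearMap ∘ₗ TensorProduct.map comul LinearMap.id)
          (TensorProduct.map LinearMap.id comul t) := by
    intro t
    rw [← LinearMap.comp_apply, ← TensorProduct.map_comp]
    rfl
  have h3 := congr($key (TensorProduct.map LinearMap.id comul (comul x)))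
  have h4 : TensorProduct.map (antipode K) ((TensorProduct.lid K H).toLinearMap ∘ₗ
      TensorProduct.map counit LinearMap.id) (TensorProduct.map LinearMap.id comul (comul x)) =
      TensorProduct.map (antipode K) LinearMap.id (comul x) := by
    rw [← LinearMap.comp_apply, ← TensorProduct.map_comp]
    congr 2
    ext y
    have : TensorProduct.map counit LinearMap.id (comul (R := K) y) = (1 : K) ⊗ₜ y :=
      rTensor_counit_comul y
    simp [this]
  have h5 : mul' K H (TensorProduct.map (antipode K) LinearMap.id (comul x)) =
      algebraMap K H (counit x) := mul_antipode_rTensor_comul_apply x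
  rw [convH_apply, h1, map_comul_comul_apply, h2]
  refine h3.trans ?_
  simp only [LinearMap.comp_apply] at h4 ⊢
  rw [h4, h5]
  simp [Algebra.algebraMap_eq_smul_one, Algebra.TensorProduct.one_def]

theorem comul_antipode (x : H) :
    comul (R := K) (antipode K x) =
      TensorProduct.map (antipode K) (antipode K) (TensorProduct.comm K H H (comul x)) := by
  have h := left_inv_eq_right_inv (congrArg toConv (convH_antipode_comul (K := K) (H := H)))
    LinearMap.comul_right_inv
  exact congr($(h.symm) x)

theorem map_mul_id_coalgHom : ∃ φ : (H ⊗[K] H) ⊗[K] H →ₗc[K] H ⊗[K] H,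
    φ.toLinearMap = TensorProduct.map (mul' K H) LinearMap.id :=
  ⟨Coalgebra.TensorProduct.map (Bialgebra.mulCoalgHom K H) (CoalgHom.id K H), rfl⟩

theorem map_id_mul_coalgHom : ∃ φ : H ⊗[K] (H ⊗[K] H) →ₗc[K] H ⊗[K] H,
    φ.toLinearMap = TensorProduct.map LinearMap.id (mul' K H) :=
  ⟨Coalgebra.TensorProduct.map (CoalgHom.id K H) (Bialgebra.mulCoalgHom K H), rfl⟩

theorem assoc_symm_coalgHom : ∃ φ : H ⊗[K] (H ⊗[K] H) →ₗc[K] (H ⊗[K] H) ⊗[K] H,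
    φ.toLinearMap = (TensorProduct.assoc K H H H).symm.toLinearMap :=
  ⟨((Coalgebra.TensorProduct.assoc K K H H H).symm : _ →ₗc[K] _), rfl⟩

theorem convH_comp_mul {A : Type u} [Ring A] [Algebra K A] (f g : H →ₗ[K] A) :
    convH K f g ∘ₗ mul' K H =
      convH K (f ∘ₗ mul' K H) (g ∘ₗ mul' K H) :=
  convH_comp_coalgHom f g (Bialgebra.mulCoalgHom K H)

theorem aMul_comp_map_id_aMul (α : H ⊗[K] H →ₗ[K] K) :
    aMul K H α ∘ₗ TensorProduct.map LinearMap.id (aMul K H α) =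
      convH K (Algebra.linearMap K H ∘ₗ cocycleRHS K H α)
        (mul' K H ∘ₗ TensorProduct.map LinearMap.id (mul' K H)) := by
  obtain ⟨φ, hφ⟩ := map_id_mul_coalgHom (K := K) (H := H)
  have h : aMul K H α ∘ₗ TensorProduct.map LinearMap.id (aMul K H α) = _ :=
    comp_map_id_convH (aMul K H α) α (mul' K H)
  rw [h, ← hφ, aMul, convH_comp_coalgHom, ← convH_assoc, cocycleRHS,
    linearMap_comp_convH, ← hφ]
  rfl

theorem aMul_comp_map_aMul_id (α : H ⊗[K] H →ₗ[K] K) :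
    aMul K H α ∘ₗ TensorProduct.map (aMul K H α) LinearMap.id ∘ₗ
        (TensorProduct.assoc K H H H).symm.toLinearMap =
      convH K (Algebra.linearMap K H ∘ₗ cocycleLHS K H α)
        (mul' K H ∘ₗ TensorProduct.map (mul' K H) LinearMap.id ∘ₗ
        (TensorProduct.assoc K H H H).symm.toLinearMap) := by
  obtain ⟨φ, hφ⟩ := map_mul_id_coalgHom (K := K) (H := H)
  obtain ⟨ψ, hψ⟩ := assoc_symm_coalgHom (K := K) (H := H)
  have h : aMul K H α ∘ₗ TensorProduct.map (aMul K H α) LinearMap.id = _ :=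
    comp_map_convH_id (aMul K H α) α (mul' K H)
  rw [← LinearMap.comp_assoc, h, ← hφ, aMul, convH_comp_coalgHom, ← hψ, convH_comp_coalgHom,
    convH_comp_coalgHom, ← convH_assoc, cocycleLHS, linearMap_comp_convH, ← hφ, ← hψ]
  rfl

theorem aMul_assoc {α : H ⊗[K] H →ₗ[K] K} (hα : IsHopfCocycle K H α) (x y z : H) :
    aMul K H α (aMul K H α (x ⊗ₜ y) ⊗ₜ z) = aMul K H α (x ⊗ₜ aMul K H α (y ⊗ₜ z)) := by
  have h1 := congr($(aMul_comp_map_id_aMul α) (x ⊗ₜ (y ⊗ₜ z)))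
  have h2 := congr($(aMul_comp_map_aMul_id α) (x ⊗ₜ (y ⊗ₜ z)))
  have h3 : mul' K H ∘ₗ TensorProduct.map (mul' K H) LinearMap.id ∘ₗ
        (TensorProduct.assoc K H H H).symm.toLinearMap =
      mul' K H ∘ₗ TensorProduct.map LinearMap.id (mul' K H) := by
    ext; simp [mul_assoc]
  rw [hα.cocycle, h3, ← h1] at h2
  simpa using h2

theorem Af_comp_aMul (α : H ⊗[K] H →ₗ[K] K) (f : H →ₗ[K] K) :
    Af K H f ∘ₗ aMul K H α =
      convH K (aMul K H α) (Algebra.linearMap K H ∘ₗ f ∘ₗ mul' K H) := by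
  rw [aMul, comp_convH_left, Af, convH_comp_mul, convH_assoc]
  rfl

theorem convH_linearMap_left_apply {C A : Type u} [AddCommGroup C] [Module K C] [Coalgebra K C]
    [Ring A] [Algebra K A] (u : C →ₗ[K] K) (v : C →ₗ[K] A) (c : C) :
    convH K (Algebra.linearMap K A ∘ₗ u) v c =
      TensorProduct.lid K A (TensorProduct.map u v (comul c)) := by
  rw [convH_apply]
  induction comul (R := K) c with
  | zero => simp
  | add s t hs ht => simp only [map_add, hs, ht]
  | tmul a b => simp [← Algebra.smul_def]

theorem convH_linearMap_right_apply {C A : Type u} [AddCommGroup C] [Module K C] [Coalgebra K C]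
    [Ring A] [Algebra K A] (u : C →ₗ[K] K) (v : C →ₗ[K] A) (c : C) :
    convH K v (Algebra.linearMap K A ∘ₗ u) c =
      TensorProduct.rid K A (TensorProduct.map v u (comul c)) := by
  rw [convH_apply]
  induction comul (R := K) c with
  | zero => simp
  | add s t hs ht => simp only [map_add, hs, ht]
  | tmul a b => simp [← Algebra.commutes, ← Algebra.smul_def]

/-- Coassociativity in the form `Δ(x₁) ⊗ x₂ = (x₁ ⊗ x₂) ⊗ x₃`. -/
theorem map_comul_id_comul {C : Type u} [AddCommGroup C] [Module K C] [Coalgebra K C] (x : C) :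
    TensorProduct.map comul LinearMap.id (comul (R := K) x) =
      (TensorProduct.assoc K C C C).symm (TensorProduct.map LinearMap.id comul (comul x)) :=
  (coassoc_symm_apply x).symm

section Sweedler
variable {C M N P : Type u} [AddCommGroup C] [Module K C] [Coalgebra K C]
  [AddCommGroup M] [Module K M] [AddCommGroup N] [Module K N] [AddCommGroup P] [Module K P]

/-- Coassociativity in the form `v(x₁₁) ⊗ u(x₁₂) ⊗ w(x₂) = v(x₁) ⊗ u(x₂₁) ⊗ w(x₂₂)`. -/
theorem map_map_comul_left (v : C →ₗ[K] M) (u : C →ₗ[K] N) (w : C →ₗ[K] P) (x : C) :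
    TensorProduct.map (TensorProduct.map v u ∘ₗ comul) w (comul (R := K) x) =
      (TensorProduct.assoc K M N P).symm
        (TensorProduct.map v (TensorProduct.map u w ∘ₗ comul) (comul x)) := by
  have h := congr(TensorProduct.map (TensorProduct.map v u) w $(map_comul_id_comul (K := K) x))
  have h1 : TensorProduct.map (TensorProduct.map v u ∘ₗ comul) w =
      TensorProduct.map (TensorProduct.map v u) w ∘ₗ
        TensorProduct.map (comul (R := K) (A := C)) LinearMap.id := by
    ext; simp
  rw [h1, LinearMap.comp_apply, h, map_map_assoc_symm, ← LinearMap.comp_apply,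
    ← TensorProduct.map_comp, LinearMap.comp_id]

/-- In Sweedler form, `v(x₁) ⊗ u(x₂) w(x₃)` computed in two ways. -/
theorem map_lid_map_comul (v : C →ₗ[K] M) (u : C →ₗ[K] K) (w : C →ₗ[K] P) (x : C) :
    TensorProduct.map v ((TensorProduct.lid K P).toLinearMap ∘ₗ TensorProduct.map u w ∘ₗ comul)
        (comul (R := K) x) =
      TensorProduct.map ((TensorProduct.rid K M).toLinearMap ∘ₗ TensorProduct.map v u ∘ₗ comul) w
        (comul x) := by
  have h := congr(TensorProduct.map (TensorProduct.rid K M).toLinearMap LinearMap.id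
    $(map_map_comul_left v u w x))
  have h1 : TensorProduct.map (TensorProduct.rid K M).toLinearMap LinearMap.id ∘ₗ
      (TensorProduct.assoc K M K P).symm.toLinearMap =
      TensorProduct.map LinearMap.id (TensorProduct.lid K P).toLinearMap := by
    ext; simp
  have h2 := congr($h1 (TensorProduct.map v (TensorProduct.map u w ∘ₗ comul) (comul x)))
  simp only [LinearMap.comp_apply, LinearEquiv.coe_coe] at h2
  rw [h2] at h
  simp only [map_map, LinearMap.id_comp] at h
  exact h.symm

/-- In Sweedler form, `(u(x₁) ⊗ v(x₂)) s(x₃)` computed in two ways. -/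
theorem map_rid_map_comul (u : C →ₗ[K] M) (v : C →ₗ[K] N) (s : C →ₗ[K] K) (x : C) :
    TensorProduct.map u ((TensorProduct.rid K N).toLinearMap ∘ₗ TensorProduct.map v s ∘ₗ comul)
        (comul (R := K) x) =
      TensorProduct.rid K (M ⊗[K] N) (TensorProduct.map (TensorProduct.map u v ∘ₗ comul) s
        (comul x)) := by
  have h := congr(TensorProduct.rid K (M ⊗[K] N) $(map_map_comul_left u v s x))
  have h1 : (TensorProduct.rid K (M ⊗[K] N)).toLinearMap ∘ₗ
      (TensorProduct.assoc K M N K).symm.toLinearMap =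
      TensorProduct.map LinearMap.id (TensorProduct.rid K N).toLinearMap := by
    ext; simp
  have h2 := congr($h1 (TensorProduct.map u (TensorProduct.map v s ∘ₗ comul) (comul x)))
  simp only [LinearMap.comp_apply, LinearEquiv.coe_coe] at h2
  rw [h2] at h
  simp only [map_map, LinearMap.id_comp] at h
  exact h.symm

/-- In Sweedler form, `s(x₁) (u(x₂) ⊗ v(x₃))` computed in two ways. -/
theorem map_lid_map_comul_left (s : C →ₗ[K] K) (u : C →ₗ[K] M) (v : C →ₗ[K] N) (x : C) :
    TensorProduct.map ((TensorProduct.lid K M).toLinearMap ∘ₗ TensorProduct.map s u ∘ₗ comul) v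
        (comul (R := K) x) =
      TensorProduct.lid K (M ⊗[K] N) (TensorProduct.map s (TensorProduct.map u v ∘ₗ comul)
        (comul x)) := by
  have h := congr(TensorProduct.map (TensorProduct.lid K M).toLinearMap LinearMap.id
    $(map_map_comul_left s u v x))
  have h1 : TensorProduct.map (TensorProduct.lid K M).toLinearMap LinearMap.id ∘ₗ
      (TensorProduct.assoc K K M N).symm.toLinearMap =
      (TensorProduct.lid K (M ⊗[K] N)).toLinearMap := by
    ext; simp
  have h2 := congr($h1 (TensorProduct.map s (TensorProduct.map u v ∘ₗ comul) (comul x)))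
  simp only [LinearMap.comp_apply, LinearEquiv.coe_coe] at h2
  rw [h2] at h
  simp only [map_map, LinearMap.id_comp] at h
  exact h
end Sweedler

theorem Af_eq (f : H →ₗ[K] K) :
    Af K H f = (TensorProduct.rid K H).toLinearMap ∘ₗ TensorProduct.map LinearMap.id f ∘ₗ comul :=
  LinearMap.ext (convH_linearMap_right_apply _ _)

theorem tAntipode_eq (γ' : H →ₗ[K] K) :
    tAntipode K H γ' = (TensorProduct.rid K H).toLinearMap ∘ₗ
      TensorProduct.map (antipode K) γ' ∘ₗ comul :=
  LinearMap.ext (convH_linearMap_right_apply _ _)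

theorem aMul_eq (α : H ⊗[K] H →ₗ[K] K) :
    aMul K H α = (TensorProduct.lid K H).toLinearMap ∘ₗ
      TensorProduct.map α (mul' K H) ∘ₗ comul :=
  LinearMap.ext (convH_linearMap_left_apply _ _)

theorem comul_Af (f : H →ₗ[K] K) (x : H) :
    comul (R := K) (Af K H f x) = TensorProduct.map LinearMap.id (Af K H f) (comul x) := by
  have h := map_rid_map_comul (LinearMap.id (R := K) (M := H)) (LinearMap.id (R := K) (M := H)) f x
  rw [Af_eq, h]
  simp only [LinearMap.comp_apply, TensorProduct.map_id, LinearMap.id_comp]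
  induction comul (R := K) x with
  | zero => simp
  | add s t hs ht => simp only [map_add, hs, ht]
  | tmul a b => simp

theorem comul_tAntipode (γ' : H →ₗ[K] K) (x : H) :
    comul (R := K) (tAntipode K H γ' x) =
      TensorProduct.map (tAntipode K H γ') (antipode K) (TensorProduct.comm K H H (comul x)) := by
  have h := congr(TensorProduct.comm K H H $(map_rid_map_comul (antipode K (A := H))
    (antipode K (A := H)) γ' x))
  rw [TensorProduct.map_comm, tAntipode_eq, h]
  simp only [LinearMap.comp_apply]
  induction comul (R := K) x with
  | zero => simp
  | add s t hs ht => simp only [map_add, hs, ht]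
  | tmul a b => simp [comul_antipode, TensorProduct.map_comm]

theorem aMul_comp_map_comm (α : H ⊗[K] H →ₗ[K] K) (u v : H →ₗ[K] H)
    (h : ∀ x, comul (R := K) (u x) = TensorProduct.map u v (TensorProduct.comm K H H (comul x)))
    (hv : ∀ x y, v (x * y) = v y * v x) :
    aMul K H α ∘ₗ TensorProduct.map u u ∘ₗ (TensorProduct.comm K H H).toLinearMap =
      convH K (v ∘ₗ mul' K H) (Algebra.linearMap K H ∘ₗ α ∘ₗ TensorProduct.map u u ∘ₗ
        (TensorProduct.comm K H H).toLinearMap) := by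
  ext x y
  rw [aMul_eq]
  simp only [AlgebraTensorModule.curry_apply, restrictScalars_self,
    curry_apply, LinearMap.comp_apply, LinearEquiv.coe_coe, comm_tmul,
    map_tmul, comul_tmul_eq, h, convH_linearMap_right_apply]
  induction comul (R := K) x with
  | zero => simp
  | add s t hs ht => simp only [add_tmul, tmul_add, map_add, hs, ht]
  | tmul a b =>
    induction comul (R := K) y with
    | zero => simp
    | add s t hs ht => simp only [add_tmul, tmul_add, map_add, hs, ht]
    | tmul c d => simp [hv]

/-- `h ⊗ g ↦ h g₁ ⊗ w(g₂)`. -/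
noncomputable def leftMulComul (w : H →ₗ[K] H) : H ⊗[K] H →ₗ[K] H ⊗[K] H :=
  TensorProduct.map (mul' K H) LinearMap.id ∘ₗ
    (TensorProduct.assoc K H H H).symm.toLinearMap ∘ₗ
      TensorProduct.map LinearMap.id (TensorProduct.map LinearMap.id w ∘ₗ comul)

theorem leftMulComul_tmul (w : H →ₗ[K] H) (h g : H) :
    leftMulComul w (h ⊗ₜ g) = TensorProduct.map (mulLeft K h) w (comul g) := by
  simp only [leftMulComul, LinearMap.comp_apply, map_tmul]
  induction comul (R := K) g with
  | zero => simp
  | add s t hs ht => simp only [map_add, hs, ht, tmul_add]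
  | tmul a b => simp

/-- `(h₁ ⊗ h₂) ⊗ ((a₁ ⊗ a₂) ⊗ (b₁ ⊗ b₂)) ↦ (h₁ a₁ ⊗ S(b₂)) ⊗ h₂ a₂ S(b₁)`. -/
noncomputable def mulAntipodeAux (s : H ⊗[K] H) :
    (H ⊗[K] H) ⊗[K] (H ⊗[K] H) →ₗ[K] (H ⊗[K] H) ⊗[K] H :=
  TensorProduct.map LinearMap.id (mul' K H) ∘ₗ
    (tensorTensorTensorComm K H H H H).toLinearMap ∘ₗ
      TensorProduct.map (mulLeft K s) (TensorProduct.map (antipode K) (antipode K) ∘ₗ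
        (TensorProduct.comm K H H).toLinearMap)

theorem map_id_mul_comul_leftMulComul (h g : H) :
    TensorProduct.map LinearMap.id (mul' K H)
        (comul (R := K) (leftMulComul (antipode K) (h ⊗ₜ[K] g))) =
      TensorProduct.map (leftMulComul (antipode K) ∘ₗ (TensorProduct.mk K H H).flip g)
        LinearMap.id (comul h) := by
  have h1 : ∀ t : H ⊗[K] H, TensorProduct.map LinearMap.id (mul' K H)
        (comul (R := K) (TensorProduct.map (mulLeft K h) (antipode K) t)) =
      mulAntipodeAux (comul h) (TensorProduct.map comul comul t) := by
    intro t
    induction t with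
    | zero => simp
    | add s t hs ht => simp only [map_add, hs, ht]
    | tmul a b =>
      simp [mulAntipodeAux, comul_antipode, Bialgebra.comul_mul,
        AlgebraTensorModule.tensorTensorTensorComm_eq]
  have h2 : ∀ (u v a c : H) (t : H ⊗[K] H), mulAntipodeAux (u ⊗ₜ v)
      ((TensorProduct.assoc K H H (H ⊗[K] H)).symm
        (a ⊗ₜ (TensorProduct.assoc K H H H (t ⊗ₜ c)))) =
      (u * a) ⊗ₜ antipode K c ⊗ₜ
        (v * mul' K H (TensorProduct.map LinearMap.id (antipode K) t)) := by
    intro u v a c t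
    induction t with
    | zero => simp
    | add s t hs ht =>
      simp only [map_add, hs, ht, tmul_add, add_tmul, mul_add]
    | tmul a b => simp [mulAntipodeAux, mul_assoc]
  have h3 : ∀ (u v a : H) (q : H ⊗[K] H), mulAntipodeAux (u ⊗ₜ v)
      ((TensorProduct.assoc K H H (H ⊗[K] H)).symm
        (a ⊗ₜ (TensorProduct.assoc K H H H (TensorProduct.map comul LinearMap.id q)))) =
      (u * a) ⊗ₜ antipode K
        (TensorProduct.lid K H (TensorProduct.map counit LinearMap.id q)) ⊗ₜ v := by
    intro u v a q
    induction q with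
    | zero => simp
    | add s t hs ht =>
      simp only [map_add, hs, ht, tmul_add, add_tmul]
    | tmul b c =>
      have hb : mul' K H (TensorProduct.map LinearMap.id (antipode K) (comul b)) =
        algebraMap K H (counit b) := mul_antipode_lTensor_comul_apply b
      simp only [map_tmul, h2, hb, LinearMap.id_apply]
      simp [Algebra.algebraMap_eq_smul_one, smul_tmul']
  have h4 : ∀ (u v : H) (r : H ⊗[K] H), mulAntipodeAux (u ⊗ₜ v)
      ((TensorProduct.assoc K H H (H ⊗[K] H)).symm (TensorProduct.map LinearMap.id
          ((TensorProduct.assoc K H H H).toLinearMap ∘ₗ TensorProduct.map comul LinearMap.id ∘ₗ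
            comul) r)) = TensorProduct.map (mulLeft K u) (antipode K) r ⊗ₜ v := by
    intro u v r
    induction r with
    | zero => simp
    | add s t hs ht => simp only [map_add, hs, ht, add_tmul]
    | tmul a b =>
      have hb : TensorProduct.map counit LinearMap.id (comul (R := K) b) = (1 : K) ⊗ₜ b :=
        rTensor_counit_comul b
      simp only [map_tmul, LinearMap.comp_apply, LinearEquiv.coe_coe, h3, hb,
        LinearMap.id_apply]
      simp
  rw [leftMulComul_tmul, h1, map_comul_comul_apply]
  induction comul (R := K) h with
  | zero => simp [mulAntipodeAux]
  | add s t hs ht =>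
    rw [map_add, ← hs, ← ht]
    simp only [mulAntipodeAux, LinearMap.comp_apply, ← LinearMap.map_add]
    rw [← LinearMap.add_apply, ← map_add_left]
    congr 4
    exact LinearMap.ext fun x => add_mul s t x
  | tmul u v => simp [h4, leftMulComul_tmul]

/-- `α(h₁ g₁, S(g₂)) h₂ g₃ S(g₄) = θ(h₁, g) h₂`, where `θ(h, g) = α(h g₁, S(g₂))`. -/
theorem aMul_leftMulComul_antipode (α : H ⊗[K] H →ₗ[K] K) (h g : H) :
    aMul K H α (leftMulComul (antipode K) (h ⊗ₜ[K] g)) =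
      TensorProduct.lid K H (TensorProduct.map
        (α ∘ₗ leftMulComul (antipode K) ∘ₗ (TensorProduct.mk K H H).flip g)
        LinearMap.id (comul h)) := by
  have h1 := congr(TensorProduct.lid K H (TensorProduct.map α LinearMap.id
    $(map_id_mul_comul_leftMulComul (K := K) h g)))
  simp only [map_map, LinearMap.id_comp, LinearMap.comp_id] at h1
  rw [← h1, aMul_eq]
  rfl

/-- The cocycle condition in the form `α(x ·_α y, z) = α(x, y ·_α z)`. -/
theorem cocycle_aMul {α : H ⊗[K] H →ₗ[K] K} (hα : IsHopfCocycle K H α)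
    (t : (H ⊗[K] H) ⊗[K] H) :
    α (TensorProduct.map (aMul K H α) LinearMap.id t) =
      α (TensorProduct.map LinearMap.id (aMul K H α) (TensorProduct.assoc K H H H t)) := by
  obtain ⟨ψ, hψ⟩ := assoc_symm_coalgHom (K := K) (H := H)
  have h1 : α ∘ₗ TensorProduct.map LinearMap.id (aMul K H α) = cocycleRHS K H α :=
    comp_map_id_convH α α (mul' K H)
  have h2 : α ∘ₗ TensorProduct.map (aMul K H α) LinearMap.id = _ :=
    comp_map_convH_id α α (mul' K H)
  have h3 : (α ∘ₗ TensorProduct.map (aMul K H α) LinearMap.id) ∘ₗ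
      (TensorProduct.assoc K H H H).symm.toLinearMap = cocycleLHS K H α := by
    rw [h2, ← hψ, convH_comp_coalgHom, cocycleLHS, ← hψ]
    rfl
  rw [hα.cocycle, ← h1] at h3
  simpa using congr($h3 (TensorProduct.assoc K H H H t))

theorem convH_mul_map_map {C D : Type u} [AddCommGroup C] [Module K C] [Coalgebra K C]
    [AddCommGroup D] [Module K D] [Coalgebra K D] (a c : C →ₗ[K] K) (b d : D →ₗ[K] K) :
    convH K (mul' K K ∘ₗ TensorProduct.map a b)
        (mul' K K ∘ₗ TensorProduct.map c d) =
      mul' K K ∘ₗ TensorProduct.map (convH K a c) (convH K b d) := by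
  ext x y
  simp only [AlgebraTensorModule.curry_apply, restrictScalars_self,
    curry_apply, LinearMap.comp_apply, map_tmul, convH_apply,
    comul_tmul_eq]
  induction comul (R := K) x with
  | zero => simp
  | add s t hs ht => simp only [add_tmul, map_add, hs, ht]
  | tmul p q =>
    induction comul (R := K) y with
    | zero => simp
    | add s t hs ht => simp only [tmul_add, map_add, hs, ht]
    | tmul r s => simp; ring

theorem convH_counit_right_apply {C D : Type u} [AddCommGroup C] [Module K C] [Coalgebra K C]
    [AddCommGroup D] [Module K D] [Coalgebra K D] (θ : C ⊗[K] D →ₗ[K] K) (c : C →ₗ[K] K)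
    (x : C) (y : D) :
    convH K θ (mul' K K ∘ₗ TensorProduct.map c counit) (x ⊗ₜ y) =
      convH K (θ ∘ₗ (TensorProduct.mk K C D).flip y) c x := by
  have h : ∀ (s : C ⊗[K] C) (t : D ⊗[K] D), mul' K K (TensorProduct.map θ
      (mul' K K ∘ₗ TensorProduct.map c counit)
      (tensorTensorTensorComm K C C D D (s ⊗ₜ t))) =
      mul' K K (TensorProduct.map (θ ∘ₗ (TensorProduct.mk K C D).flip
        (TensorProduct.rid K D (TensorProduct.map LinearMap.id counit t))) c s) := by
    intro s t
    induction s with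
    | zero => simp
    | add s s' hs ht => simp only [add_tmul, map_add, hs, ht]
    | tmul p q =>
      induction t with
      | zero => simp
      | add s t hs ht =>
        simp only [tmul_add, map_add, hs, ht, map_tmul,
          LinearMap.comp_apply, mul'_apply, LinearMap.add_apply, add_mul]
      | tmul r s => simp; ring
  have hy : TensorProduct.map LinearMap.id counit (comul (R := K) y) = y ⊗ₜ (1 : K) :=
    lTensor_counit_comul y
  simp only [convH_apply, comul_tmul_eq, h, hy, rid_tmul, one_smul]

theorem convH_counit_left_apply {C D : Type u} [AddCommGroup C] [Module K C] [Coalgebra K C]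
    [AddCommGroup D] [Module K D] [Coalgebra K D] (θ : C ⊗[K] D →ₗ[K] K) (d : D →ₗ[K] K)
    (x : C) (y : D) :
    convH K θ (mul' K K ∘ₗ TensorProduct.map counit d) (x ⊗ₜ y) =
      convH K (θ ∘ₗ TensorProduct.mk K C D x) d y := by
  have h : ∀ (s : C ⊗[K] C) (t : D ⊗[K] D), mul' K K (TensorProduct.map θ
      (mul' K K ∘ₗ TensorProduct.map counit d)
      (tensorTensorTensorComm K C C D D (s ⊗ₜ t))) =
      mul' K K (TensorProduct.map (θ ∘ₗ TensorProduct.mk K C D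
        (TensorProduct.rid K C (TensorProduct.map LinearMap.id counit s))) d t) := by
    intro s t
    induction t with
    | zero => simp
    | add s s' hs ht => simp only [tmul_add, map_add, hs, ht]
    | tmul p q =>
      induction s with
      | zero => simp
      | add s t hs ht =>
        simp only [add_tmul, map_add, hs, ht, map_tmul,
          LinearMap.comp_apply, mul'_apply, LinearMap.add_apply]
      | tmul r s => simp; ring
  have hx : TensorProduct.map LinearMap.id counit (comul (R := K) x) = x ⊗ₜ (1 : K) :=
    lTensor_counit_comul x
  simp only [convH_apply, comul_tmul_eq, h, hx, rid_tmul, one_smul]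

theorem convH_eq_lid {C : Type u} [AddCommGroup C] [Module K C] [Coalgebra K C]
    (u v : C →ₗ[K] K) (c : C) :
    convH K u v c = TensorProduct.lid K K (TensorProduct.map u v (comul c)) :=
  convH_linearMap_left_apply u v c

theorem convH_eq_rid {C : Type u} [AddCommGroup C] [Module K C] [Coalgebra K C]
    (u v : C →ₗ[K] K) (c : C) :
    convH K u v c = TensorProduct.rid K K (TensorProduct.map u v (comul c)) :=
  convH_linearMap_right_apply v u c

theorem map_lid_apply {M N P : Type u} [AddCommGroup M] [Module K M] [AddCommGroup N] [Module K N]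
    [AddCommGroup P] [Module K P] (L : N →ₗ[K] P) (s : M →ₗ[K] K) (V : M →ₗ[K] N)
    (t : M ⊗[K] M) :
    L (TensorProduct.lid K N (TensorProduct.map s V t)) =
      TensorProduct.lid K P (TensorProduct.map s (L ∘ₗ V) t) := by
  induction t with
  | zero => simp
  | add s t hs ht => simp only [map_add, hs, ht]
  | tmul a b => simp

theorem map_rid_apply {M N P : Type u} [AddCommGroup M] [Module K M] [AddCommGroup N] [Module K N]
    [AddCommGroup P] [Module K P] (L : N →ₗ[K] P) (s : M →ₗ[K] K) (V : M →ₗ[K] N)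
    (t : M ⊗[K] M) :
    L (TensorProduct.rid K N (TensorProduct.map V s t)) =
      TensorProduct.rid K P (TensorProduct.map (L ∘ₗ V) s t) := by
  induction t with
  | zero => simp
  | add s t hs ht => simp only [map_add, hs, ht]
  | tmul a b => simp

theorem assoc_map_leftMulComul_antipode (h g : H) :
    TensorProduct.assoc K H H H (TensorProduct.map
      (leftMulComul (antipode K) ∘ₗ (TensorProduct.mk K H H).flip g) (antipode K) (comul h)) =
    TensorProduct.map (mul' K H) (TensorProduct.map (antipode K) (antipode K) ∘ₗ
      (TensorProduct.comm K H H).toLinearMap) (comul (R := K) (h ⊗ₜ[K] g)) := by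
  rw [comul_tmul_eq]
  induction comul (R := K) h with
  | zero => simp
  | add s t hs ht => simp only [map_add, hs, ht, add_tmul]
  | tmul a b =>
    simp only [map_tmul, LinearMap.comp_apply, flip_apply,
      mk_apply, leftMulComul_tmul]
    induction comul (R := K) g with
    | zero => simp
    | add s t hs ht => simp only [map_add, hs, ht, add_tmul, tmul_add]
    | tmul c d => simp

theorem cocycleGamma_comp_mul (α : H ⊗[K] H →ₗ[K] K) :
    cocycleGamma K H α ∘ₗ mul' K H =
      α ∘ₗ TensorProduct.map (mul' K H) (antipode K ∘ₗ mul' K H) ∘ₗ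
        comul := by
  have h : TensorProduct.map (mul' K H) (mul' K H) ∘ₗ comul =
      comul ∘ₗ mul' K H := (Bialgebra.mulCoalgHom K H).map_comp_comul
  rw [cocycleGamma, LinearMap.comp_assoc, LinearMap.comp_assoc, ← h, ← LinearMap.comp_assoc _ _
    (TensorProduct.map LinearMap.id _), ← TensorProduct.map_comp, LinearMap.id_comp]

/-- `γ(h₁ g₁) α(S(g₂), S(h₂)) = α(h₁ g₁, S(g₂)) γ(h₂)`. -/
theorem convH_cocycleGamma_comp_mul {α : H ⊗[K] H →ₗ[K] K} (hα : IsHopfCocycle K H α) :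
    convH K (cocycleGamma K H α ∘ₗ mul' K H)
        (α ∘ₗ TensorProduct.map (antipode K) (antipode K) ∘ₗ
          (TensorProduct.comm K H H).toLinearMap) =
      convH K (α ∘ₗ leftMulComul (antipode K))
        (mul' K K ∘ₗ TensorProduct.map (cocycleGamma K H α) counit) := by
  have hm := aMul_comp_map_comm α (antipode K) (antipode K) comul_antipode
    antipode_mul_antidistrib
  have e2 : ∀ g : H, aMul K H α ∘ₗ leftMulComul (antipode K) ∘ₗ (TensorProduct.mk K H H).flip g =
      (TensorProduct.lid K H).toLinearMap ∘ₗ TensorProduct.map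
        (α ∘ₗ leftMulComul (antipode K) ∘ₗ (TensorProduct.mk K H H).flip g)
        LinearMap.id ∘ₗ comul := fun g =>
    LinearMap.ext fun h => aMul_leftMulComul_antipode α h g
  ext h g
  have key := cocycle_aMul hα (TensorProduct.map
      (leftMulComul (antipode K) ∘ₗ (TensorProduct.mk K H H).flip g) (antipode K) (comul h))
  rw [assoc_map_leftMulComul_antipode, map_map, map_map, e2, hm,
    LinearMap.id_comp, LinearMap.id_comp] at key
  have e3 := map_lid_map_comul_left (α ∘ₗ leftMulComul (antipode K) ∘ₗ
    (TensorProduct.mk K H H).flip g) LinearMap.id (antipode K) h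
  have e4 := map_rid_map_comul (mul' K H) (antipode K ∘ₗ mul' K H)
    (α ∘ₗ TensorProduct.map (antipode K)
    (antipode K) ∘ₗ (TensorProduct.comm K H H).toLinearMap) (h ⊗ₜ[K] g)
  have e5 : convH K (antipode K ∘ₗ mul' K H) (Algebra.linearMap K H ∘ₗ α ∘ₗ
      TensorProduct.map (antipode K) (antipode K) ∘ₗ
      (TensorProduct.comm K H H).toLinearMap) = (TensorProduct.rid K H).toLinearMap ∘ₗ
      TensorProduct.map (antipode K ∘ₗ mul' K H) (α ∘ₗ
      TensorProduct.map (antipode K) (antipode K) ∘ₗ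
      (TensorProduct.comm K H H).toLinearMap) ∘ₗ comul :=
    LinearMap.ext fun c => convH_linearMap_right_apply _ _ c
  rw [e5, e3, e4, map_lid_apply, map_rid_apply] at key
  have e6 := cocycleGamma_comp_mul α
  simp only [AlgebraTensorModule.curry_apply, restrictScalars_self,
    curry_apply, convH_counit_right_apply]
  rw [e6, convH_eq_rid, convH_eq_lid]
  exact key.symm

theorem convH_comp_map_comm {C A : Type u} [AddCommGroup C] [Module K C] [Coalgebra K C]
    [Ring A] [Algebra K A] (α : A ⊗[K] A →ₗ[K] K) (u : C →ₗ[K] A) (v : C →ₗ[K] K) :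
    α ∘ₗ TensorProduct.map (convH K u (Algebra.linearMap K A ∘ₗ v))
        (convH K u (Algebra.linearMap K A ∘ₗ v)) ∘ₗ (TensorProduct.comm K C C).toLinearMap =
      convH K (α ∘ₗ TensorProduct.map u u ∘ₗ (TensorProduct.comm K C C).toLinearMap)
        (mul' K K ∘ₗ TensorProduct.map v v) := by
  ext x y
  simp only [AlgebraTensorModule.curry_apply, restrictScalars_self,
    curry_apply, LinearMap.comp_apply, LinearEquiv.coe_coe, comm_tmul,
    map_tmul, comul_tmul_eq, convH_linearMap_right_apply, convH_apply _ _ (_ ⊗ₜ _)]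
  induction comul (R := K) x with
  | zero => simp
  | add s t hs ht => simp only [add_tmul, tmul_add, map_add, hs, ht]
  | tmul a b =>
    induction comul (R := K) y with
    | zero => simp
    | add s t hs ht => simp only [add_tmul, tmul_add, map_add, hs, ht]
    | tmul c d =>
      simp [← smul_tmul']
      ring

/-- The functional `κ(h, g) = α(h g₁, S(g₂)) γ'(g₃)`. -/
noncomputable def leftMulKernel (α : H ⊗[K] H →ₗ[K] K) (γ' : H →ₗ[K] K) : H ⊗[K] H →ₗ[K] K :=
  convH K (α ∘ₗ leftMulComul (antipode K)) (mul' K K ∘ₗ TensorProduct.map counit γ')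

theorem counit_comp_mul :
    counit ∘ₗ mul' K H = (counit (R := K) (A := H ⊗[K] H)) :=
  (Bialgebra.mulCoalgHom K H).counit_comp

/-- `S̃(h₁ g₁) κ(h₂, g₂) = S̃(g) ·_α S̃(h)`. -/
theorem convH_tAntipode_leftMulKernel {α : H ⊗[K] H →ₗ[K] K} (hα : IsHopfCocycle K H α)
    {γ' : H →ₗ[K] K} (h₁ : convH K (cocycleGamma K H α) γ' = counit)
    (h₂ : convH K γ' (cocycleGamma K H α) = counit) :
    convH K (tAntipode K H γ' ∘ₗ mul' K H)
        (Algebra.linearMap K H ∘ₗ leftMulKernel α γ') =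
      aMul K H α ∘ₗ TensorProduct.map (tAntipode K H γ') (tAntipode K H γ') ∘ₗ
        (TensorProduct.comm K H H).toLinearMap := by
  have core : α ∘ₗ TensorProduct.map (tAntipode K H γ') (tAntipode K H γ') ∘ₗ
        (TensorProduct.comm K H H).toLinearMap =
      convH K (γ' ∘ₗ mul' K H) (leftMulKernel α γ') := by
    have hinv : convH K (γ' ∘ₗ mul' K H) (cocycleGamma K H α ∘ₗ mul' K H) =
        counit := by
      rw [← convH_comp_mul, h₂, counit_comp_mul]
    have hsplit : mul' K K ∘ₗ TensorProduct.map γ' γ' =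
        convH K (mul' K K ∘ₗ TensorProduct.map γ' counit)
          (mul' K K ∘ₗ TensorProduct.map counit γ') := by
      rw [convH_mul_map_map, convH_counit, counit_convH]
    have hcancel : convH K (mul' K K ∘ₗ TensorProduct.map (cocycleGamma K H α) counit)
        (mul' K K ∘ₗ TensorProduct.map γ' counit) =
          (counit (R := K) (A := H ⊗[K] H)) := by
      rw [convH_mul_map_map, h₁, convH_counit]
      ext
      simp [mul_comm]
    have hcancel' : ∀ w : H ⊗[K] H →ₗ[K] K,
        convH K (mul' K K ∘ₗ TensorProduct.map (cocycleGamma K H α) counit)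
          (convH K (mul' K K ∘ₗ TensorProduct.map γ' counit) w) = w := fun w => by
      rw [← convH_assoc, hcancel, counit_convH]
    have hσ : α ∘ₗ TensorProduct.map (antipode K) (antipode K) ∘ₗ
          (TensorProduct.comm K H H).toLinearMap =
        convH K (γ' ∘ₗ mul' K H) (convH K (α ∘ₗ leftMulComul (antipode K))
          (mul' K K ∘ₗ TensorProduct.map (cocycleGamma K H α) counit)) := by
      rw [← convH_cocycleGamma_comp_mul hα, ← convH_assoc, hinv, counit_convH]
    rw [tAntipode, convH_comp_map_comm, hsplit, hσ, convH_assoc, convH_assoc,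
      hcancel']
    rfl
  rw [aMul_comp_map_comm α (tAntipode K H γ') (antipode K) (comul_tAntipode γ')
    antipode_mul_antidistrib, core, linearMap_comp_convH, ← convH_assoc, tAntipode,
    convH_comp_mul]
  rfl

/-- `h g₁ ·_α S̃(g₂) = κ(h₁, g) h₂`. -/
theorem aMul_leftMulComul_tAntipode (α : H ⊗[K] H →ₗ[K] K) (γ' : H →ₗ[K] K) (h g : H) :
    aMul K H α (leftMulComul (tAntipode K H γ') (h ⊗ₜ[K] g)) =
      TensorProduct.lid K H (TensorProduct.map
        (leftMulKernel α γ' ∘ₗ (TensorProduct.mk K H H).flip g) LinearMap.id (comul h)) := by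
  have e1 : leftMulKernel α γ' ∘ₗ (TensorProduct.mk K H H).flip g =
    (TensorProduct.rid K K).toLinearMap ∘ₗ TensorProduct.map LinearMap.id γ' ∘ₗ
      TensorProduct.map (α ∘ₗ leftMulComul (antipode K) ) LinearMap.id ∘ₗ
      (TensorProduct.assoc K H H H).symm.toLinearMap ∘ₗ
        (TensorProduct.mk K H (H ⊗[K] H)).flip (comul g) := by
    ext x
    simp only [leftMulKernel, LinearMap.comp_apply, flip_apply, mk_apply,
      convH_counit_left_apply, LinearEquiv.coe_coe]
    rw [convH_eq_rid]
    induction comul (R := K) g with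
    | zero => simp
    | add s t hs ht => simp only [map_add, hs, ht, tmul_add]
    | tmul a b => simp
  have e2 := map_rid_map_comul (mulLeft K h) (antipode K) γ' g
  have e3 : leftMulComul (tAntipode K H γ') (h ⊗ₜ[K] g) =
      TensorProduct.rid K (H ⊗[K] H) (TensorProduct.map
        (leftMulComul (antipode K) ∘ₗ TensorProduct.mk K H H h) γ' (comul g)) := by
    rw [leftMulComul_tmul, tAntipode_eq, e2]
    congr 3
    ext x
    simp [leftMulComul_tmul]
  rw [e3, map_rid_apply, e1]
  generalize comul (R := K) g = t
  induction t with
  | zero =>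
    rw [map_zero, map_zero]
    simp
  | add s t hs ht =>
    rw [map_add, map_add, hs, ht]
    simp only [map_add, LinearMap.comp_add, map_add_left, LinearMap.add_apply]
  | tmul a b =>
    simp only [map_tmul, rid_tmul, LinearMap.comp_apply,
      mk_apply, aMul_leftMulComul_antipode]
    induction comul (R := K) h with
    | zero => simp
    | add s t hs ht => simp only [map_add, hs, ht, smul_add]
    | tmul c d => simp [smul_smul]

theorem Tmap_tmul (α : H ⊗[K] H →ₗ[K] K) (γ' : H →ₗ[K] K) (x h : H) :
    Tmap K H α γ' (x ⊗ₜ[K] h) =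
      TensorProduct.map (aMul K H α ∘ₗ TensorProduct.mk K H H x ∘ₗ tAntipode K H γ')
        LinearMap.id (comul h) := by
  simp only [Tmap, LinearMap.comp_apply, map_tmul]
  induction comul (R := K) h with
  | zero => simp
  | add s t hs ht => simp only [map_add, hs, ht, tmul_add]
  | tmul a b => simp

theorem map_id_Af_comp_Tmap (α : H ⊗[K] H →ₗ[K] K) (γ' f : H →ₗ[K] K) :
    TensorProduct.map LinearMap.id (Af K H f) ∘ₗ Tmap K H α γ' =
      Tmap K H α γ' ∘ₗ TensorProduct.map LinearMap.id (Af K H f) := by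
  ext x h
  simp [Tmap_tmul, comul_Af, map_map]

theorem Af_aMul_tmul (α : H ⊗[K] H →ₗ[K] K) (f : H →ₗ[K] K) (x y : H) :
    Af K H f (aMul K H α (x ⊗ₜ[K] y)) =
      TensorProduct.rid K H (TensorProduct.map (aMul K H α) (f ∘ₗ mul' K H)
        (tensorTensorTensorComm K H H H H (comul x ⊗ₜ comul y))) := by
  have h := congr($(Af_comp_aMul α f) (x ⊗ₜ[K] y))
  rwa [convH_linearMap_right_apply] at h

theorem map_Af_id_comp_Tmap (α : H ⊗[K] H →ₗ[K] K) (γ' f : H →ₗ[K] K) :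
    TensorProduct.map (Af K H f) LinearMap.id ∘ₗ Tmap K H α γ' =
      (TensorProduct.rid K (H ⊗[K] H)).toLinearMap ∘ₗ
        TensorProduct.map (Tmap K H α γ')
          (f ∘ₗ mul' K H ∘ₗ TensorProduct.map LinearMap.id (antipode K)) ∘ₗ
          swapPerm K H ∘ₗ (comul (A := H ⊗[K] H)) := by
  ext x h
  have e1 : Af K H f ∘ₗ aMul K H α ∘ₗ TensorProduct.mk K H H x ∘ₗ tAntipode K H γ' =
      (TensorProduct.rid K H).toLinearMap ∘ₗ
        TensorProduct.map (aMul K H α) (f ∘ₗ mul' K H) ∘ₗ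
        (tensorTensorTensorComm K H H H H).toLinearMap ∘ₗ
        TensorProduct.mk K (H ⊗[K] H) (H ⊗[K] H) (comul x) ∘ₗ
        TensorProduct.map (tAntipode K H γ') (antipode K) ∘ₗ
        (TensorProduct.comm K H H).toLinearMap ∘ₗ comul := by
    ext k
    simp only [LinearMap.comp_apply, mk_apply, Af_aMul_tmul, comul_tAntipode,
      LinearEquiv.coe_coe]
  have e2 : ∀ a b : H, (TensorProduct.rid K H).toLinearMap ∘ₗ
        TensorProduct.map (aMul K H α) (f ∘ₗ mul' K H) ∘ₗ
        (tensorTensorTensorComm K H H H H).toLinearMap ∘ₗ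
        TensorProduct.mk K (H ⊗[K] H) (H ⊗[K] H) (a ⊗ₜ b) ∘ₗ
        TensorProduct.map (tAntipode K H γ') (antipode K) ∘ₗ
        (TensorProduct.comm K H H).toLinearMap ∘ₗ comul =
      (TensorProduct.lid K H).toLinearMap ∘ₗ
        TensorProduct.map (f ∘ₗ mulLeft K b ∘ₗ antipode K)
          (aMul K H α ∘ₗ TensorProduct.mk K H H a ∘ₗ tAntipode K H γ') ∘ₗ comul := by
    intro a b
    ext k
    simp only [LinearMap.comp_apply]
    induction comul (R := K) k with
    | zero => simp
    | add s t hs ht => simp only [map_add, hs, ht]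
    | tmul c d => simp
  have e3 : ∀ a : H, TensorProduct.map (aMul K H α ∘ₗ TensorProduct.mk K H H a ∘ₗ
      tAntipode K H γ') LinearMap.id ∘ₗ comul = Tmap K H α γ' ∘ₗ TensorProduct.mk K H H a :=
    fun a => LinearMap.ext fun k => (Tmap_tmul α γ' a k).symm
  simp only [AlgebraTensorModule.curry_apply, restrictScalars_self,
    curry_apply, LinearMap.comp_apply _ _ (_ ⊗ₜ _), Tmap_tmul,
    map_map, e1, LinearMap.id_comp, comul_tmul_eq]
  induction comul (R := K) x with
  | zero => simp
  | add s t hs ht =>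
    simp only [add_tmul, map_add, ← hs, ← ht]
    simp only [LinearMap.comp_add, LinearMap.add_comp, map_add_left,
      LinearMap.add_apply]
  | tmul a b =>
    rw [e2, map_lid_map_comul_left, e3]
    induction comul (R := K) h with
    | zero => simp
    | add s t hs ht => simp only [map_add, hs, ht, tmul_add]
    | tmul c d => simp [swapPerm]

theorem Tmap_leftMulComul (α : H ⊗[K] H →ₗ[K] K) (γ' : H →ₗ[K] K) :
    Tmap K H α γ' ∘ₗ leftMulComul LinearMap.id =
      (TensorProduct.lid K (H ⊗[K] H)).toLinearMap ∘ₗ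
        TensorProduct.map (leftMulKernel α γ') LinearMap.id ∘ₗ comul := by
  ext h g
  have e1 := map_map_comul_left (mulLeft K h) (tAntipode K H γ') LinearMap.id g
  have e2 : TensorProduct.map (mulLeft K h) (tAntipode K H γ') ∘ₗ comul =
      leftMulComul (tAntipode K H γ') ∘ₗ TensorProduct.mk K H H h :=
    LinearMap.ext fun k => (leftMulComul_tmul _ h k).symm
  have e3 : Tmap K H α γ' (leftMulComul LinearMap.id (h ⊗ₜ g)) =
      TensorProduct.map (aMul K H α ∘ₗ leftMulComul (tAntipode K H γ') ∘ₗ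
        TensorProduct.mk K H H h) LinearMap.id (comul g) := by
    rw [leftMulComul_tmul, Tmap]
    simp only [LinearMap.comp_apply, map_map, LinearMap.id_comp, LinearMap.comp_id,
      LinearEquiv.coe_coe, ← e1, e2]
  simp only [AlgebraTensorModule.curry_apply, restrictScalars_self,
    curry_apply, LinearMap.comp_apply, e3, comul_tmul_eq]
  induction comul (R := K) g with
  | zero => simp
  | add s t hs ht => simp only [map_add, hs, ht, tmul_add]
  | tmul a b =>
    simp only [map_tmul, LinearMap.comp_apply, mk_apply,
      aMul_leftMulComul_tAntipode]
    induction comul (R := K) h with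
    | zero => simp
    | add s t hs ht => simp only [map_add, hs, ht, add_tmul]
    | tmul c d => simp [smul_tmul']

/-- `(hg₁)₁ ⊗ (hg₁)₂ ⊗ g₂ = h₁ g₁ ⊗ h₂ g₂ ⊗ g₃`. -/
theorem assoc_map_comul_leftMulComul (c : H ⊗[K] H) :
    TensorProduct.assoc K H H H (TensorProduct.map comul LinearMap.id
        (leftMulComul LinearMap.id c)) =
      TensorProduct.map (mul' K H) (leftMulComul LinearMap.id) (comul c) := by
  induction c with
  | zero => simp
  | add s t hs ht => simp only [map_add, hs, ht]
  | tmul h g =>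
    have e1 : TensorProduct.map (comul (R := K)) LinearMap.id (leftMulComul LinearMap.id (h ⊗ₜ g)) =
        TensorProduct.map (mulLeft K (comul h)) LinearMap.id
          (TensorProduct.map comul LinearMap.id (comul g)) := by
      rw [leftMulComul_tmul, map_map, map_map]
      congr 2
      ext k
      simp [Bialgebra.comul_mul]
    rw [e1, map_comul_id_comul, comul_tmul_eq]
    induction comul (R := K) h with
    | zero => simp
    | add s t hs ht =>
      have e2 : mulLeft K (s + t) = mulLeft K s + mulLeft K t :=
        LinearMap.ext fun _ => add_mul _ _ _
      simp only [e2, map_add, ← hs, ← ht, add_tmul, map_add_left,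
        LinearMap.add_apply]
    | tmul a b =>
      induction comul (R := K) g with
      | zero => simp
      | add s t hs ht => simp only [map_add, hs, ht, tmul_add]
      | tmul c d =>
        simp only [map_tmul, tensorTensorTensorComm_tmul,
          leftMulComul_tmul]
        induction comul (R := K) d with
        | zero => simp
        | add s t hs ht => simp only [map_add, hs, ht, tmul_add]
        | tmul p q => simp

theorem assoc_map_Tmap_assoc_symm (α : H ⊗[K] H →ₗ[K] K) (γ' : H →ₗ[K] K) (x : H)
    (c : H ⊗[K] H) :
    TensorProduct.assoc K H H H (TensorProduct.map (Tmap K H α γ') LinearMap.id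
        ((TensorProduct.assoc K H H H).symm (x ⊗ₜ c))) =
      TensorProduct.map (aMul K H α ∘ₗ TensorProduct.mk K H H x ∘ₗ tAntipode K H γ')
        LinearMap.id
        (TensorProduct.assoc K H H H (TensorProduct.map comul LinearMap.id c)) := by
  induction c with
  | zero => simp
  | add s t hs ht => simp only [map_add, hs, ht, tmul_add]
  | tmul a b =>
    simp only [assoc_symm_tmul, map_tmul, Tmap_tmul,
      LinearMap.id_apply]
    induction comul (R := K) a with
    | zero => simp
    | add s t hs ht => simp only [map_add, hs, ht, add_tmul]
    | tmul p q => simp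

theorem rid_map_leftMulKernel {α : H ⊗[K] H →ₗ[K] K} (hα : IsHopfCocycle K H α)
    {γ' : H →ₗ[K] K} (h₁ : convH K (cocycleGamma K H α) γ' = counit)
    (h₂ : convH K γ' (cocycleGamma K H α) = counit) (x : H) :
    (TensorProduct.rid K H).toLinearMap ∘ₗ TensorProduct.map
      ((aMul K H α ∘ₗ TensorProduct.mk K H H x ∘ₗ tAntipode K H γ') ∘ₗ mul' K H)
      (leftMulKernel α γ') ∘ₗ comul =
    aMul K H α ∘ₗ TensorProduct.mk K H H x ∘ₗ aMul K H α ∘ₗ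
      TensorProduct.map (tAntipode K H γ') (tAntipode K H γ') ∘ₗ
      (TensorProduct.comm K H H).toLinearMap := by
  rw [← convH_tAntipode_leftMulKernel hα h₁ h₂]
  refine LinearMap.ext fun c => ?_
  have h := map_rid_apply (aMul K H α ∘ₗ TensorProduct.mk K H H x) (leftMulKernel α γ')
    (tAntipode K H γ' ∘ₗ mul' K H) (comul c)
  rw [← convH_linearMap_right_apply] at h
  simp only [LinearMap.comp_assoc] at h ⊢
  exact h.symm

theorem Tmap_pentagon {α : H ⊗[K] H →ₗ[K] K} (hα : IsHopfCocycle K H α)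
    {γ' : H →ₗ[K] K} (h₁ : convH K (cocycleGamma K H α) γ' = counit)
    (h₂ : convH K γ' (cocycleGamma K H α) = counit) :
    (TensorProduct.assoc K H H H).toLinearMap ∘ₗ
        TensorProduct.map (Tmap K H α γ') LinearMap.id ∘ₗ
          (TensorProduct.assoc K H H H).symm.toLinearMap ∘ₗ
            TensorProduct.map LinearMap.id (TensorProduct.comm K H H).toLinearMap ∘ₗ
              (TensorProduct.assoc K H H H).toLinearMap ∘ₗ
                TensorProduct.map (Tmap K H α γ') LinearMap.id ∘ₗ
                  (TensorProduct.assoc K H H H).symm.toLinearMap ∘ₗ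
                    TensorProduct.map LinearMap.id (TensorProduct.comm K H H).toLinearMap =
      TensorProduct.map LinearMap.id (Tmap K H α γ') ∘ₗ
        (TensorProduct.assoc K H H H).toLinearMap ∘ₗ
          TensorProduct.map (Tmap K H α γ') LinearMap.id ∘ₗ
            (TensorProduct.assoc K H H H).symm.toLinearMap ∘ₗ
              TensorProduct.map LinearMap.id
                (TensorProduct.map (mul' K H) LinearMap.id ∘ₗ
                  (TensorProduct.assoc K H H H).symm.toLinearMap ∘ₗ
                    TensorProduct.map LinearMap.id comul) := by
  have e1 : TensorProduct.map (mul' K H) LinearMap.id ∘ₗ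
      (TensorProduct.assoc K H H H).symm.toLinearMap ∘ₗ TensorProduct.map LinearMap.id comul =
      leftMulComul (K := K) (H := H) LinearMap.id := by
    rw [leftMulComul, TensorProduct.map_id, LinearMap.id_comp]
  rw [e1]
  refine TensorProduct.ext' fun x c => ?_
  have hR : (TensorProduct.map LinearMap.id (Tmap K H α γ') ∘ₗ
        (TensorProduct.assoc K H H H).toLinearMap ∘ₗ
          TensorProduct.map (Tmap K H α γ') LinearMap.id ∘ₗ
            (TensorProduct.assoc K H H H).symm.toLinearMap ∘ₗ
              TensorProduct.map LinearMap.id (leftMulComul LinearMap.id)) (x ⊗ₜ c) =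
      TensorProduct.map (aMul K H α ∘ₗ TensorProduct.mk K H H x ∘ₗ aMul K H α ∘ₗ
        TensorProduct.map (tAntipode K H γ') (tAntipode K H γ') ∘ₗ
        (TensorProduct.comm K H H).toLinearMap) LinearMap.id (comul c) := by
    simp only [LinearMap.comp_apply, map_tmul, LinearEquiv.coe_coe,
      assoc_map_Tmap_assoc_symm, assoc_map_comul_leftMulComul, map_map,
      LinearMap.id_comp, Tmap_leftMulComul, map_lid_map_comul, LinearMap.id_apply]
    rw [rid_map_leftMulKernel hα h₁ h₂]
  rw [hR]
  clear hR
  induction c with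
  | zero => simp only [tmul_zero, map_zero]
  | add s t hs ht => simp only [map_add, ← hs, ← ht, tmul_add]
  | tmul h g =>
    simp only [LinearMap.comp_apply, map_tmul, LinearEquiv.coe_coe,
      comm_tmul, assoc_symm_tmul, LinearMap.id_apply, Tmap_tmul,
      comul_tmul_eq]
    induction comul (R := K) g with
    | zero => simp
    | add s t hs ht => simp only [map_add, hs, ht, add_tmul, tmul_add]
    | tmul a b =>
      simp only [LinearMap.comp_apply, map_tmul, LinearEquiv.coe_coe,
        comm_tmul, assoc_tmul, assoc_symm_tmul,
        LinearMap.id_apply, Tmap_tmul]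
      induction comul (R := K) h with
      | zero => simp
      | add s t hs ht =>
        simp only [map_add, hs, ht, add_tmul]
      | tmul c d => simp [aMul_assoc hα]

end Hopf

end CocycleDeformation

/-- The identities
(1) `A_f(x ·_α y) = A_{f₁}(x) ·_α A_{f₂}(y)`,
(2) `(id ⊗ A_f) ∘ T_h = T_{h₁ f(h₂)}`,
(3) `(A_f ⊗ id)(T_h(x)) = f₂(S(h₁)) T_{h₂}(A_{f₁}(x))`, and
(4) `(T_h ⊗ id)(T_g(x)) = (id ⊗ T_{g₂})(T_{h g₁}(x))`
for the maps `A_f(x) = x₁ f(x₂)` and `T(x ⊗ h) = (x ·_α S̃(h₁)) ⊗ h₂` on `^αH`. -/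
theorem Af_Tmap_identities
    (K H : Type u) [Field K] [CharZero K] [Ring H] [HopfAlgebra K H]
    [FiniteDimensional K H]
    (α : H ⊗[K] H →ₗ[K] K) (hα : IsHopfCocycle K H α)
    (γ' : H →ₗ[K] K)
    (hγ' : convH K (cocycleGamma K H α) γ' = Coalgebra.counit ∧
           convH K γ' (cocycleGamma K H α) = Coalgebra.counit) :
    (∀ f : H →ₗ[K] K,
      Af K H f ∘ₗ aMul K H α =
        convH K (aMul K H α) (Algebra.linearMap K H ∘ₗ f ∘ₗ LinearMap.mul' K H)) ∧
    (∀ f : H →ₗ[K] K,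
      TensorProduct.map LinearMap.id (Af K H f) ∘ₗ Tmap K H α γ' =
        Tmap K H α γ' ∘ₗ TensorProduct.map LinearMap.id (Af K H f)) ∧
    (∀ f : H →ₗ[K] K,
      TensorProduct.map (Af K H f) LinearMap.id ∘ₗ Tmap K H α γ' =
        (TensorProduct.rid K (H ⊗[K] H)).toLinearMap ∘ₗ
          TensorProduct.map (Tmap K H α γ')
            (f ∘ₗ LinearMap.mul' K H ∘ₗ
              TensorProduct.map LinearMap.id (HopfAlgebra.antipode (R := K))) ∘ₗ
            swapPerm K H ∘ₗ (Coalgebra.comul (A := H ⊗[K] H))) ∧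
    ((TensorProduct.assoc K H H H).toLinearMap ∘ₗ
        TensorProduct.map (Tmap K H α γ') LinearMap.id ∘ₗ
          (TensorProduct.assoc K H H H).symm.toLinearMap ∘ₗ
            TensorProduct.map LinearMap.id (TensorProduct.comm K H H).toLinearMap ∘ₗ
              (TensorProduct.assoc K H H H).toLinearMap ∘ₗ
                TensorProduct.map (Tmap K H α γ') LinearMap.id ∘ₗ
                  (TensorProduct.assoc K H H H).symm.toLinearMap ∘ₗ
                    TensorProduct.map LinearMap.id (TensorProduct.comm K H H).toLinearMap =
      TensorProduct.map LinearMap.id (Tmap K H α γ') ∘ₗ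
        (TensorProduct.assoc K H H H).toLinearMap ∘ₗ
          TensorProduct.map (Tmap K H α γ') LinearMap.id ∘ₗ
            (TensorProduct.assoc K H H H).symm.toLinearMap ∘ₗ
              TensorProduct.map LinearMap.id
                (TensorProduct.map (LinearMap.mul' K H) LinearMap.id ∘ₗ
                  (TensorProduct.assoc K H H H).symm.toLinearMap ∘ₗ
                    TensorProduct.map LinearMap.id Coalgebra.comul)) := by
  exact ⟨Af_comp_aMul α, map_id_Af_comp_Tmap α γ', map_Af_id_comp_Tmap α γ',
    Tmap_pentagon hα hγ'.1 hγ'.2⟩
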